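/- arXiv:2402.05228 — 2 statements merged into one kernel-verified Lean document; each statement's English description precedes it below -/
import Mathlib

section
/- Let H be an m×n matrix over F₂, let i be a row index, and let H̃ be the single-row reduction of H at row i via a row expansion f of size r. Then the map sending a codeword c ∈ C(H̃) to its restriction to the first n coordinates is an F₂-linear bijection from C(H̃) onto C(H). Consequently dim C(H̃) = dim C(H) and rank H̃ = rank H + (r−1). -/
open Matrix

/-- The `r × (r-1)` matrix `T_r` over `F₂` with `(T_r)_{j,k} = 1` iff `j = k` or
`j = k + 1`; it is the transpose of a parity-check matrix of the `[r,1,r]`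
binary repetition code. -/
def Trep (r : ℕ) : Matrix (Fin r) (Fin (r - 1)) (ZMod 2) :=
  Matrix.of fun j k => if (j : ℕ) = (k : ℕ) ∨ (j : ℕ) = (k : ℕ) + 1 then 1 else 0

/-- `f` is a row expansion of the row `h`: each column of `f` indexed by an element of the
support of `h` has Hamming weight exactly 1, and all other columns of `f` are zero. -/
def IsRowExpansion {κ : Type*} [Fintype κ] (h : κ → ZMod 2) {r : ℕ}
    (f : Matrix (Fin r) κ (ZMod 2)) : Prop :=
  ∀ j : κ, (h j ≠ 0 → hammingNorm (fun a => f a j) = 1) ∧ (h j = 0 → ∀ a, f a j = 0)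

/-- The single-row reduction of `H` at row `i` via the expansion `f`: the rows of `H`
other than row `i` are kept (extended by zeros in the new columns), and row `i` is
replaced by the block `(f | T_r)`. -/
def singleRowReduction {m n : ℕ} (H : Matrix (Fin m) (Fin n) (ZMod 2)) (i : Fin m)
    {r : ℕ} (f : Matrix (Fin r) (Fin n) (ZMod 2)) :
    Matrix ({j : Fin m // j ≠ i} ⊕ Fin r) (Fin n ⊕ Fin (r - 1)) (ZMod 2) :=
  Matrix.of fun a b =>
    match a, b with
    | Sum.inl j, Sum.inl cc => H j.1 cc
    | Sum.inl _, Sum.inr _ => 0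
    | Sum.inr a, Sum.inl cc => f a cc
    | Sum.inr a, Sum.inr k => Trep r a k


/-- A vector extended by zero to a sequence indexed by the natural numbers. -/
def zeroExtend {s : ℕ} (x : Fin s → ZMod 2) (k : ℕ) : ZMod 2 :=
  if h : k < s then x ⟨k, h⟩ else 0

theorem sum_ite_val_eq {s : ℕ} (x : Fin s → ZMod 2) (p : ℕ) :
    (∑ k : Fin s, if p = (k : ℕ) then x k else 0) = zeroExtend x p := by
  unfold zeroExtend
  split_ifs with h
  · rw [Finset.sum_eq_single ⟨p, h⟩]
    · simp
    · intro b _ hb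
      exact if_neg fun e => hb (Fin.ext e.symm)
    · simp
  · exact Finset.sum_eq_zero fun k _ => if_neg (by have := k.isLt; omega)

theorem Trep_mulVec_of_val_eq_zero {r : ℕ} (x : Fin (r - 1) → ZMod 2) (a : Fin r)
    (ha : (a : ℕ) = 0) : (Trep r *ᵥ x) a = zeroExtend x 0 := by
  rw [← sum_ite_val_eq]
  simp [mulVec, dotProduct, Trep, ha]

theorem Trep_mulVec_of_val_eq_succ {r : ℕ} (x : Fin (r - 1) → ZMod 2) (a : Fin r) {p : ℕ}
    (ha : (a : ℕ) = p + 1) :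
    (Trep r *ᵥ x) a = zeroExtend x (p + 1) + zeroExtend x p := by
  rw [← sum_ite_val_eq, ← sum_ite_val_eq, ← Finset.sum_add_distrib]
  simp only [mulVec, dotProduct]
  refine Finset.sum_congr rfl fun k _ => ?_
  simp only [Trep, of_apply, ha, Nat.add_right_cancel_iff]
  split_ifs <;> first | omega | simp

theorem eq_zero_of_Trep_mulVec_eq_zero {r : ℕ} {x : Fin (r - 1) → ZMod 2}
    (hx : Trep r *ᵥ x = 0) : x = 0 := by
  have key : ∀ p, p < r → zeroExtend x p = 0 := by
    intro p
    induction p with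
    | zero =>
      intro hp
      rw [← Trep_mulVec_of_val_eq_zero x ⟨0, hp⟩ rfl, hx, Pi.zero_apply]
    | succ p ih =>
      intro hp
      have h := Trep_mulVec_of_val_eq_succ x ⟨p + 1, hp⟩ rfl
      rw [hx, ih (by omega), add_zero] at h
      exact h.symm
  funext k
  have h := key k (by omega)
  simpa [zeroExtend] using h

theorem sum_Trep_mulVec {r : ℕ} (x : Fin (r - 1) → ZMod 2) :
    ∑ a, (Trep r *ᵥ x) a = 0 := by
  have hcol : ∀ k, ∑ a, Trep r a k = 0 := by
    intro k
    have h : ∀ a : Fin r, Trep r a k = (if a = ⟨k, by omega⟩ then 1 else 0) +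
        (if a = ⟨k + 1, by omega⟩ then 1 else 0) := by
      intro a
      simp only [Trep, of_apply, Fin.ext_iff]
      split_ifs <;> first | omega | simp
    simp only [h, Finset.sum_add_distrib, Finset.sum_ite_eq', Finset.mem_univ, if_true]
    decide
  simp only [mulVec, dotProduct]
  rw [Finset.sum_comm]
  simp [← Finset.sum_mul, hcol]

theorem exists_Trep_mulVec_eq {r : ℕ} (y : Fin r → ZMod 2) (hy : ∑ a, y a = 0) :
    ∃ x, Trep r *ᵥ x = y := by
  let S : ℕ → ZMod 2 := fun k => ∑ j ∈ Finset.range k, zeroExtend y j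
  have hS : S r = 0 := by
    rw [← hy]
    simp only [S]
    rw [← Fin.sum_univ_eq_sum_range]
    simp [zeroExtend]
  have hx : ∀ p, p < r → zeroExtend (fun k : Fin (r - 1) => S (k + 1)) p = S (p + 1) := by
    intro p hp
    by_cases h : p < r - 1
    · simp [zeroExtend, h]
    · obtain rfl : r = p + 1 := by omega
      simp [zeroExtend, hS]
  refine ⟨fun k => S (k + 1), funext fun a => ?_⟩
  obtain ⟨p, hp⟩ := a
  cases p with
  | zero =>
    rw [Trep_mulVec_of_val_eq_zero _ _ rfl, hx 0 hp]
    simp [S, zeroExtend, hp]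
  | succ p =>
    rw [Trep_mulVec_of_val_eq_succ _ _ rfl, hx _ hp, hx p (by omega)]
    have hstep : S (p + 1 + 1) = S (p + 1) + y ⟨p + 1, hp⟩ := by
      simp only [S]
      rw [Finset.sum_range_succ]
      simp [zeroExtend, hp]
    rw [hstep, add_right_comm, CharTwo.add_self_eq_zero, zero_add]

/-- The rows of a row expansion sum to the expanded row. -/
theorem IsRowExpansion.sum_apply {κ : Type*} [Fintype κ] {h : κ → ZMod 2} {r : ℕ}
    {f : Matrix (Fin r) κ (ZMod 2)} (hf : IsRowExpansion h f) (j : κ) :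
    ∑ a, f a j = h j := by
  have ne_zero_iff : ∀ z : ZMod 2, z ≠ 0 ↔ z = 1 := by decide
  by_cases hj : h j = 0
  · simp [hj, (hf j).2 hj]
  · have hw := (hf j).1 hj
    have hfa : ∀ a, f a j = if f a j ≠ 0 then 1 else 0 := by
      intro a
      split_ifs with h0
      · exact (ne_zero_iff _).1 h0
      · exact not_not.1 h0
    rw [Finset.sum_congr rfl fun a _ => hfa a, Finset.sum_boole]
    rw [hammingNorm] at hw
    rw [hw, (ne_zero_iff _).1 hj, Nat.cast_one]

theorem IsRowExpansion.sum_mulVec {κ : Type*} [Fintype κ] {h : κ → ZMod 2} {r : ℕ}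
    {f : Matrix (Fin r) κ (ZMod 2)} (hf : IsRowExpansion h f) (u : κ → ZMod 2) :
    ∑ a, (f *ᵥ u) a = h ⬝ᵥ u := by
  simp only [mulVec, dotProduct]
  rw [Finset.sum_comm]
  simp [← Finset.sum_mul, hf.sum_apply]

theorem singleRowReduction_mulVec_eq_zero_iff {m n r : ℕ}
    (H : Matrix (Fin m) (Fin n) (ZMod 2)) (i : Fin m) (f : Matrix (Fin r) (Fin n) (ZMod 2))
    (c : Fin n ⊕ Fin (r - 1) → ZMod 2) :
    singleRowReduction H i f *ᵥ c = 0 ↔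
      (∀ j, j ≠ i → (H *ᵥ (c ∘ Sum.inl)) j = 0) ∧
        Trep r *ᵥ (c ∘ Sum.inr) = f *ᵥ (c ∘ Sum.inl) := by
  have hl : ∀ j, (singleRowReduction H i f *ᵥ c) (Sum.inl j) = (H *ᵥ (c ∘ Sum.inl)) j := by
    intro j
    simp [mulVec, dotProduct, singleRowReduction, Fintype.sum_sum_type]
  have hr : ∀ a, (singleRowReduction H i f *ᵥ c) (Sum.inr a) =
      (f *ᵥ (c ∘ Sum.inl)) a + (Trep r *ᵥ (c ∘ Sum.inr)) a := by
    intro a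
    simp [mulVec, dotProduct, singleRowReduction, Fintype.sum_sum_type]
  simp only [funext_iff, Sum.forall, hl, hr, Pi.zero_apply, Subtype.forall,
    CharTwo.add_eq_zero, eq_comm (a := (f *ᵥ (c ∘ Sum.inl)) _)]

theorem mulVec_inl_eq_zero_of_singleRowReduction {m n r : ℕ}
    {H : Matrix (Fin m) (Fin n) (ZMod 2)} {i : Fin m} {f : Matrix (Fin r) (Fin n) (ZMod 2)}
    (hf : IsRowExpansion (H i) f) {c : Fin n ⊕ Fin (r - 1) → ZMod 2}
    (hc : singleRowReduction H i f *ᵥ c = 0) : H *ᵥ (c ∘ Sum.inl) = 0 := by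
  rw [singleRowReduction_mulVec_eq_zero_iff] at hc
  funext j
  by_cases hj : j = i
  · subst hj
    change H j ⬝ᵥ (c ∘ Sum.inl) = 0
    rw [← hf.sum_mulVec, ← hc.2, sum_Trep_mulVec]
  · exact hc.1 j hj

/-- Restriction of codewords of the single-row reduction to the original coordinates. -/
def restrictCodeword {m n r : ℕ} {H : Matrix (Fin m) (Fin n) (ZMod 2)} {i : Fin m}
    {f : Matrix (Fin r) (Fin n) (ZMod 2)} (hf : IsRowExpansion (H i) f) :
    LinearMap.ker (singleRowReduction H i f).mulVecLin →ₗ[ZMod 2]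
      LinearMap.ker H.mulVecLin :=
  (LinearMap.funLeft (ZMod 2) (ZMod 2) Sum.inl).restrict fun _ hc =>
    mulVec_inl_eq_zero_of_singleRowReduction hf hc

theorem restrictCodeword_bijective {m n r : ℕ} {H : Matrix (Fin m) (Fin n) (ZMod 2)}
    {i : Fin m} {f : Matrix (Fin r) (Fin n) (ZMod 2)} (hf : IsRowExpansion (H i) f) :
    Function.Bijective (restrictCodeword hf) := by
  constructor
  · rw [injective_iff_map_eq_zero]
    rintro ⟨c, hc⟩ h
    have hu : c ∘ Sum.inl = 0 := congrArg Subtype.val h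
    have hx := ((singleRowReduction_mulVec_eq_zero_iff H i f c).1 hc).2
    rw [hu, mulVec_zero] at hx
    have hv := eq_zero_of_Trep_mulVec_eq_zero hx
    ext k
    rcases k with k | k
    · exact congrFun hu k
    · exact congrFun hv k
  · rintro ⟨u, hu⟩
    have hu' : H *ᵥ u = 0 := hu
    obtain ⟨x, hx⟩ := exists_Trep_mulVec_eq (f *ᵥ u)
      ((hf.sum_mulVec u).trans (congrFun hu' i))
    refine ⟨⟨Sum.elim u x, ?_⟩, rfl⟩
    exact (singleRowReduction_mulVec_eq_zero_iff H i f _).2 ⟨fun j _ => congrFun hu' j, hx⟩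

/-- Restriction to the first `n` coordinates is an `F₂`-linear bijection from the kernel
code of the single-row reduction `H̃` onto the kernel code of `H`; consequently the two
codes have the same dimension and `rank H̃ = rank H + (r - 1)`. -/
theorem stmt1 {m n r : ℕ} (hr : 2 ≤ r)
    (H : Matrix (Fin m) (Fin n) (ZMod 2)) (i : Fin m)
    (f : Matrix (Fin r) (Fin n) (ZMod 2)) (hf : IsRowExpansion (H i) f) :
    (∃ e : LinearMap.ker (singleRowReduction H i f).mulVecLin ≃ₗ[ZMod 2]
        LinearMap.ker H.mulVecLin,
      ∀ c : LinearMap.ker (singleRowReduction H i f).mulVecLin,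
        (e c : Fin n → ZMod 2) = fun j => (c : (Fin n ⊕ Fin (r - 1)) → ZMod 2) (Sum.inl j)) ∧
    Module.finrank (ZMod 2) (LinearMap.ker (singleRowReduction H i f).mulVecLin) =
      Module.finrank (ZMod 2) (LinearMap.ker H.mulVecLin) ∧
    (singleRowReduction H i f).rank = H.rank + (r - 1) := by
  let e := LinearEquiv.ofBijective (restrictCodeword hf) (restrictCodeword_bijective hf)
  have hdim := e.finrank_eq
  refine ⟨⟨e, fun _ => rfl⟩, hdim, ?_⟩
  have h₁ := (singleRowReduction H i f).mulVecLin.finrank_range_add_finrank_ker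
  have h₂ := H.mulVecLin.finrank_range_add_finrank_ker
  simp only [Module.finrank_fintype_fun_eq_card, Fintype.card_sum, Fintype.card_fin] at h₁ h₂
  unfold Matrix.rank
  omega
end

section
/- Let H be an m×n matrix over F₂ with all columns nonzero, and let H̃ be the full column reduction of H in which every column j is expanded via an arbitrary row expansion (of Hᵀ) of size r_j ≥ 2 (each expansion matrix has Hamming-weight-one columns on the support of the corresponding column of H and zero columns elsewhere). Then every nonzero codeword of C(H̃) has Hamming weight at least d(H)·min_j r_j. In particular, taking compressed expansions of sizes r_j = q_j − 2, where q_j > 3 is the weight of column j, yields d(H̃) ≥ d(H)·min_j (q_j − 2). -/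
open Matrix

/-- The full row reduction via expansions `f i` of sizes `r i`: rows are indexed by the
disjoint union `⨆ i, Fin (r i)` and columns by `κ ⊕ ⨆ i, Fin (r i - 1)`; the `i`-th block
of rows equals `f i` on the original columns, equals `T_{r i}` on the `i`-th block of new
columns, and is zero on all other new-column blocks. -/
def fullRowReduction {ι κ : Type*} [DecidableEq ι]
    (r : ι → ℕ) (f : ∀ i, Matrix (Fin (r i)) κ (ZMod 2)) :
    Matrix ((i : ι) × Fin (r i)) (κ ⊕ (i : ι) × Fin (r i - 1)) (ZMod 2) :=
  Matrix.of fun a b =>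
    match b with
    | Sum.inl cc => f a.1 a.2 cc
    | Sum.inr k =>
        if a.1 = k.1 ∧ ((a.2 : ℕ) = (k.2 : ℕ) ∨ (a.2 : ℕ) = (k.2 : ℕ) + 1) then 1 else 0

/-- The full column reduction via expansions `f j` (of the columns, i.e. of the rows of
the transpose) of sizes `r j`: the transpose of the full row reduction of the transpose. -/
def fullColumnReduction {ι κ : Type*} [DecidableEq κ]
    (r : κ → ℕ) (f : ∀ j, Matrix (Fin (r j)) ι (ZMod 2)) :
    Matrix (ι ⊕ (j : κ) × Fin (r j - 1)) ((j : κ) × Fin (r j)) (ZMod 2) :=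
  (fullRowReduction r f)ᵀ

/-- The minimum distance of the code `C(H)`: the least Hamming weight of a nonzero
vector in the kernel of `H`. -/
noncomputable def minDist {ι κ : Type*} [Fintype ι] [Fintype κ]
    (H : Matrix ι κ (ZMod 2)) : ℕ :=
  sInf {w | ∃ v : κ → ZMod 2, v ≠ 0 ∧ H.mulVec v = 0 ∧ hammingNorm v = w}

theorem sum_eq_hammingNorm {α : Type*} [Fintype α] (g : α → ZMod 2) :
    ∑ a, g a = (hammingNorm g : ZMod 2) := by
  have h : ∀ x : ZMod 2, x = if x ≠ 0 then 1 else 0 := by decide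
  rw [hammingNorm, Finset.card_filter, Nat.cast_sum]
  refine Finset.sum_congr rfl fun a _ => ?_
  conv_lhs => rw [h (g a)]
  push_cast
  rfl

theorem hammingNorm_comp_fst {κ : Type*} [Fintype κ] {r : κ → ℕ} (v : κ → ZMod 2) :
    hammingNorm (fun x : (j : κ) × Fin (r j) => v x.1) = ∑ j with v j ≠ 0, r j := by
  simp only [hammingNorm, Finset.card_filter, Fintype.sum_sigma, Finset.sum_filter]
  refine Finset.sum_congr rfl fun j _ => ?_
  split_ifs <;> simp

section

variable {ι κ : Type*} [Fintype κ] [DecidableEq κ] {r : κ → ℕ}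

theorem fullColumnReduction_mulVec_inl (f : ∀ j, Matrix (Fin (r j)) ι (ZMod 2))
    (c : ((j : κ) × Fin (r j)) → ZMod 2) (i : ι) :
    (fullColumnReduction r f).mulVec c (Sum.inl i) = ∑ j, ∑ a, f j a i * c ⟨j, a⟩ := by
  simp only [Matrix.mulVec, dotProduct, Fintype.sum_sigma]
  rfl

theorem fullColumnReduction_mulVec_inr (f : ∀ j, Matrix (Fin (r j)) ι (ZMod 2))
    (c : ((j : κ) × Fin (r j)) → ZMod 2) (j : κ) (k : Fin (r j - 1)) :
    (fullColumnReduction r f).mulVec c (Sum.inr ⟨j, k⟩) =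
      c ⟨j, ⟨k, by omega⟩⟩ + c ⟨j, ⟨k + 1, by omega⟩⟩ := by
  simp only [Matrix.mulVec, dotProduct, Fintype.sum_sigma, fullColumnReduction,
    fullRowReduction, Matrix.transpose_apply, Matrix.of_apply]
  rw [Finset.sum_eq_single j]
  · rw [Finset.sum_eq_add (⟨k, by omega⟩ : Fin (r j)) ⟨k + 1, by omega⟩]
    · simp
    · simp [Fin.ext_iff]
    · rintro a - ⟨h1, h2⟩
      simp only [ne_eq, Fin.ext_iff] at h1 h2
      simp [h1, h2]
    · simp
    · simp
  · intro j' _ hj'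
    simp [hj']
  · simp

/-- The repetition checks force a codeword to be constant on every block. -/
theorem exists_eq_comp_fst_of_mulVec_eq_zero (hr : ∀ j, 2 ≤ r j)
    (f : ∀ j, Matrix (Fin (r j)) ι (ZMod 2))
    {c : ((j : κ) × Fin (r j)) → ZMod 2} (hc : (fullColumnReduction r f).mulVec c = 0) :
    ∃ v : κ → ZMod 2, c = fun x => v x.1 := by
  refine ⟨fun j => c ⟨j, ⟨0, by have := hr j; omega⟩⟩, ?_⟩
  funext ⟨j, a, ha⟩
  induction a with
  | zero => rfl
  | succ k ih =>
    have h := congrFun hc (Sum.inr ⟨j, ⟨k, by omega⟩⟩)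
    rw [fullColumnReduction_mulVec_inr, Pi.zero_apply] at h
    rw [← ih (by omega)]
    exact (CharTwo.add_eq_zero.1 h).symm

variable [Fintype ι]

theorem fullColumnReduction_mulVec_comp_fst_eq_zero_iff {H : Matrix ι κ (ZMod 2)}
    {f : ∀ j, Matrix (Fin (r j)) ι (ZMod 2)}
    (hf : ∀ j, IsRowExpansion (fun a => H a j) (f j)) (v : κ → ZMod 2) :
    (fullColumnReduction r f).mulVec (fun x => v x.1) = 0 ↔ H.mulVec v = 0 := by
  have hinl : ∀ i, (fullColumnReduction r f).mulVec (fun x => v x.1) (Sum.inl i) =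
      H.mulVec v i := fun i => by
    rw [fullColumnReduction_mulVec_inl]
    simp only [← Finset.sum_mul, (hf _).sum_apply]
    rfl
  constructor
  · intro h
    funext i
    rw [← hinl, h]
    rfl
  · intro h
    funext x
    rcases x with i | ⟨j, k⟩
    · rw [hinl, h]
      rfl
    · rw [fullColumnReduction_mulVec_inr, Pi.zero_apply]
      exact CharTwo.add_self_eq_zero _

theorem minDist_mul_sInf_le_hammingNorm {H : Matrix ι κ (ZMod 2)} (hr : ∀ j, 2 ≤ r j)
    {f : ∀ j, Matrix (Fin (r j)) ι (ZMod 2)}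
    (hf : ∀ j, IsRowExpansion (fun a => H a j) (f j))
    {c : ((j : κ) × Fin (r j)) → ZMod 2} (hc : c ≠ 0)
    (hker : (fullColumnReduction r f).mulVec c = 0) :
    minDist H * sInf (Set.range r) ≤ hammingNorm c := by
  obtain ⟨v, rfl⟩ := exists_eq_comp_fst_of_mulVec_eq_zero hr f hker
  have hv : v ≠ 0 := by
    rintro rfl
    exact hc rfl
  have hle : minDist H ≤ hammingNorm v :=
    Nat.sInf_le ⟨v, hv, (fullColumnReduction_mulVec_comp_fst_eq_zero_iff hf v).1 hker, rfl⟩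
  rw [hammingNorm_comp_fst]
  refine (Nat.mul_le_mul_right _ hle).trans ?_
  exact Finset.card_nsmul_le_sum _ _ _ fun j _ => Nat.sInf_le ⟨j, rfl⟩

theorem minDist_mul_sInf_le_minDist {H : Matrix ι κ (ZMod 2)} (hr : ∀ j, 2 ≤ r j)
    {f : ∀ j, Matrix (Fin (r j)) ι (ZMod 2)}
    (hf : ∀ j, IsRowExpansion (fun a => H a j) (f j)) :
    minDist H * sInf (Set.range r) ≤ minDist (fullColumnReduction r f) := by
  by_cases hH : ∃ v : κ → ZMod 2, v ≠ 0 ∧ H.mulVec v = 0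
  · obtain ⟨v, hv, hker⟩ := hH
    have hv' : (fun x : (j : κ) × Fin (r j) => v x.1) ≠ 0 := fun h =>
      hv (funext fun j => congrFun h ⟨j, ⟨0, by have := hr j; omega⟩⟩)
    obtain ⟨c, hc, hcker, hcw⟩ := Nat.sInf_mem
      (s := {w | ∃ c : ((j : κ) × Fin (r j)) → ZMod 2, c ≠ 0 ∧
        (fullColumnReduction r f).mulVec c = 0 ∧ hammingNorm c = w})
      ⟨_, _, hv', (fullColumnReduction_mulVec_comp_fst_eq_zero_iff hf v).2 hker, rfl⟩
    exact (minDist_mul_sInf_le_hammingNorm hr hf hc hcker).trans hcw.le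
  · have h0 : minDist H = 0 := by
      refine Nat.sInf_eq_zero.2 (Or.inr (Set.eq_empty_iff_forall_notMem.2 ?_))
      rintro w ⟨v, hv, hker, -⟩
      exact hH ⟨v, hv, hker⟩
    rw [h0, zero_mul]
    exact Nat.zero_le _

end

/-- For the full column reduction `H̃` of `H` (all columns nonzero) via arbitrary row
expansions of sizes `r j ≥ 2`, every nonzero codeword of `C(H̃)` has Hamming weight at
least `d(H) · min_j (r j)`. In particular, for compressed expansions of sizes
`r j = q j − 2` where `q j > 3` is the weight of column `j`, we get
`d(H̃) ≥ d(H) · min_j (q j − 2)`. -/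
theorem stmt7 {m n : ℕ}
    (H : Matrix (Fin m) (Fin n) (ZMod 2))
    (hcols : ∀ j : Fin n, ∃ a, H a j ≠ 0)
    (r : Fin n → ℕ) (hr : ∀ j, 2 ≤ r j)
    (f : ∀ j, Matrix (Fin (r j)) (Fin m) (ZMod 2))
    (hf : ∀ j, IsRowExpansion (fun a => H a j) (f j)) :
    (∀ c : ((j : Fin n) × Fin (r j)) → ZMod 2, c ≠ 0 →
        (fullColumnReduction r f).mulVec c = 0 →
        minDist H * sInf (Set.range r) ≤ hammingNorm c) ∧
    ((∀ j, r j = hammingNorm (fun a => H a j) - 2) →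
     (∀ j, 3 < hammingNorm (fun a => H a j)) →
        minDist H * sInf (Set.range fun j : Fin n => hammingNorm (fun a => H a j) - 2)
          ≤ minDist (fullColumnReduction r f)) := by
  refine ⟨fun c hc hker => minDist_mul_sInf_le_hammingNorm hr hf hc hker, fun hq _ => ?_⟩
  rw [← funext hq]
  exact minDist_mul_sInf_le_minDist hr hf
end
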